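/- Let a group G act simplicially and without inversions on a simplicial tree T. Let e₁ = {v,w} and e₂ = {v,z} be two distinct edges at a vertex v, with Stab(e₁) = {g : g·v = v, g·w = w} and Stab(e₂) = {g : g·v = v, g·z = z}. Let G_v, G_w, G_z be subgroups fixing v, w, z respectively, and let h ∈ G. Assume: C₁ := G_v ∩ Stab(e₁) = G_w ∩ Stab(e₁); C₂ := G_v ∩ Stab(e₂) = G_z ∩ Stab(e₂); w = h·z; G_w = hG_z h⁻¹; there is no a ∈ G_v with a·w = z; and there is no u ∈ G_w with u·v = h·v. Then (noting C₂ ≤ G_v and hC₂h⁻¹ ≤ G_w) the canonical homomorphism into G from the HNN extension of the amalgamated free product G_v *_{C₁} G_w along the isomorphism C₂ → hC₂h⁻¹ given by k ↦ hkh⁻¹, sending the stable letter to h, is injective; in particular the subgroup of G generated by G_v ∪ G_w ∪ {h} is isomorphic to (G_v *_{C₁} G_w)*_{C₂}. -/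

import Mathlib

/-- A two-element family of types, used to index a binary amalgamated product. -/
def BoolFam (X Y : Type u) : Bool → Type u
  | true => X
  | false => Y

instance instGroupBoolFam (X Y : Type u) [Group X] [Group Y] :
    ∀ b, Group (BoolFam X Y b)
  | true => inferInstanceAs (Group X)
  | false => inferInstanceAs (Group Y)

/-- The two inclusions of a common subgroup, as a `Bool`-indexed family of homomorphisms. -/
def boolFamHom {H : Type*} {X Y : Type u} [Group H] [Group X] [Group Y]
    (f : H →* X) (g : H →* Y) : ∀ b, H →* BoolFam X Y b
  | true => f
  | false => g

/-- The amalgamated free product `X *_H Y` of the maps `f : H →* X` and `g : H →* Y`,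
realized as an indexed pushout. -/
abbrev AmalgamatedProduct {H : Type*} {X Y : Type u} [Group H] [Group X] [Group Y]
    (f : H →* X) (g : H →* Y) : Type _ :=
  Monoid.PushoutI (boolFamHom f g)

/-- The canonical map of the left factor into the amalgamated product. -/
def AmalgamatedProduct.inl {H : Type*} {X Y : Type u} [Group H] [Group X] [Group Y]
    {f : H →* X} {g : H →* Y} : X →* AmalgamatedProduct f g :=
  Monoid.PushoutI.of (φ := boolFamHom f g) true

/-- The canonical map of the right factor into the amalgamated product. -/
def AmalgamatedProduct.inr {H : Type*} {X Y : Type u} [Group H] [Group X] [Group Y]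
    {f : H →* X} {g : H →* Y} : Y →* AmalgamatedProduct f g :=
  Monoid.PushoutI.of (φ := boolFamHom f g) false

/-- The pointwise stabilizer of the edge `{v, w}`. -/
abbrev edgeStab (G : Type*) {V : Type*} [Group G] [MulAction G V] (v w : V) : Subgroup G :=
  MulAction.stabilizer G v ⊓ MulAction.stabilizer G w

/-- The intersection `G_v ∩ Stab(e)` of a vertex group with an edge stabilizer. -/
abbrev edgeGroup {G V : Type*} [Group G] [MulAction G V]
    (Gv : Subgroup G) (v w : V) : Subgroup G :=
  Gv ⊓ edgeStab G v w

/-- The amalgamated product `G_v *_{C₁} G_w` over `C₁ = G_v ∩ Stab({v,w}) = G_w ∩ Stab({v,w})`. -/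
abbrev VertexAmalgam {G V : Type*} [Group G] [MulAction G V] {v w : V}
    (Gv Gw : Subgroup G) (hC₁ : edgeGroup Gv v w = edgeGroup Gw v w) : Type _ :=
  AmalgamatedProduct
    (Subgroup.inclusion (inf_le_left : edgeGroup Gv v w ≤ Gv))
    (Subgroup.inclusion (hC₁.le.trans inf_le_left : edgeGroup Gv v w ≤ Gw))

/-- The image in `G_v *_{C₁} G_w` of the subgroup `C₂ = G_v ∩ Stab({v,z})` of `G_v`. -/
abbrev assocSubgroupA {G V : Type*} [Group G] [MulAction G V] {v w : V} (z : V)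
    (Gv Gw : Subgroup G) (hC₁ : edgeGroup Gv v w = edgeGroup Gw v w) :
    Subgroup (VertexAmalgam Gv Gw hC₁) :=
  Subgroup.map AmalgamatedProduct.inl ((edgeGroup Gv v z).subgroupOf Gv)

/-- The image in `G_v *_{C₁} G_w` of the subgroup `h C₂ h⁻¹` of `G_w`. -/
abbrev assocSubgroupB {G V : Type*} [Group G] [MulAction G V] {v w : V} (z : V) (h : G)
    (Gv Gw : Subgroup G) (hC₁ : edgeGroup Gv v w = edgeGroup Gw v w) :
    Subgroup (VertexAmalgam Gv Gw hC₁) :=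
  Subgroup.map AmalgamatedProduct.inr
    ((Subgroup.map (MulAut.conj h).toMonoidHom (edgeGroup Gv v z)).subgroupOf Gw)

/-- The element of `assocSubgroupA` corresponding to `x ∈ C₂`. -/
def assocElemA {G V : Type*} [Group G] [MulAction G V] {v w : V} (z : V)
    (Gv Gw : Subgroup G) (hC₁ : edgeGroup Gv v w = edgeGroup Gw v w)
    (x : G) (hx : x ∈ edgeGroup Gv v z) : assocSubgroupA z Gv Gw hC₁ :=
  ⟨AmalgamatedProduct.inl ⟨x, hx.1⟩,
    Subgroup.mem_map_of_mem _ (Subgroup.mem_subgroupOf.mpr hx)⟩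

theorem SimpleGraph.Walk.isChain_edges_map {X V : Type*} {S : SimpleGraph X} {T : SimpleGraph V}
    (f : S →g T) (hf : ∀ x, Set.InjOn f (S.neighborSet x)) {x y : X} (p : S.Walk x y)
    (hp : p.edges.IsChain (· ≠ ·)) : (p.map f).edges.IsChain (· ≠ ·) := by
  induction p with
  | nil => simp
  | @cons a b _ hab q ih =>
    cases q with
    | nil => simp
    | @cons _ c _ hbc r =>
      simp only [SimpleGraph.Walk.edges_cons, List.isChain_cons_cons] at hp
      have hq := ih (by simpa only [SimpleGraph.Walk.edges_cons] using hp.2)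
      simp only [SimpleGraph.Walk.map_cons, SimpleGraph.Walk.edges_cons,
        List.isChain_cons_cons] at hq ⊢
      refine ⟨fun he => hp.1 ?_, hq⟩
      rw [Sym2.eq_swap, Sym2.congr_right] at he
      rw [Sym2.eq_swap, hf b hab.symm hbc he]

/-- A locally injective graph homomorphism to an acyclic graph is injective on connected
components. -/
theorem SimpleGraph.IsAcyclic.eq_of_locally_injective {X V : Type*} {S : SimpleGraph X}
    {T : SimpleGraph V} (hT : T.IsAcyclic) (f : S →g T)
    (hf : ∀ x, Set.InjOn f (S.neighborSet x)) {x y : X} (hxy : S.Reachable x y)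
    (he : f x = f y) : x = y := by
  obtain ⟨p, hp⟩ := hxy.exists_isPath
  have hchain := p.isChain_edges_map f hf hp.isTrail.edges_nodup.isChain
  have hpath := (hT.isPath_iff_isChain _).mpr hchain
  have hlen : (p.map f).length = 0 := by
    generalize p.map f = q at hpath
    revert q
    rw [he]
    exact fun q hq =>
      SimpleGraph.Walk.length_eq_zero_iff.mpr (SimpleGraph.Walk.isPath_iff_nil.mp hq)
  rw [SimpleGraph.Walk.length_map] at hlen
  exact SimpleGraph.Walk.eq_of_length_eq_zero hlen

section BassSerre

variable {K : Type*} [Group K]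

/-- Incidence between cosets of `A` and of `B`: `kA` is joined to `kB` and to `kt⁻¹B`. -/
def CosetIncident (A B : Subgroup K) (t : K) (p : K ⧸ A) (q : K ⧸ B) : Prop :=
  ∃ k : K, p = k ∧ (q = k ∨ q = (k * t⁻¹ : K))

/-- The bipartite graph on the cosets of `A` and of `B` in which `kA` is joined to `kB`
and to `kt⁻¹B`. -/
def cosetGraph (A B : Subgroup K) (t : K) : SimpleGraph ((K ⧸ A) ⊕ (K ⧸ B)) where
  Adj
    | .inl p, .inr q => CosetIncident A B t p q
    | .inr q, .inl p => CosetIncident A B t p q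
    | _, _ => False
  symm := ⟨by rintro (p | p) (q | q) h <;> exact h⟩
  loopless := ⟨by rintro (p | p) h <;> exact h⟩

variable {A B : Subgroup K} {t : K}

theorem CosetIncident.smul {p : K ⧸ A} {q : K ⧸ B} (h : CosetIncident A B t p q) (k : K) :
    CosetIncident A B t (k • p) (k • q) := by
  obtain ⟨l, rfl, rfl | rfl⟩ := h
  · exact ⟨k * l, rfl, Or.inl rfl⟩
  · exact ⟨k * l, rfl, Or.inr (by rw [mul_assoc]; rfl)⟩

theorem CosetIncident.exists_right {k : K} {q : K ⧸ B} (h : CosetIncident A B t k q) :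
    ∃ a ∈ A, q = (k * a : K) ∨ q = (k * a * t⁻¹ : K) := by
  obtain ⟨l, hl, hq⟩ := h
  exact ⟨k⁻¹ * l, QuotientGroup.eq.mp hl, by simpa using hq⟩

theorem CosetIncident.exists_left {k : K} {p : K ⧸ A} (h : CosetIncident A B t p k) :
    ∃ b ∈ B, p = (k * b : K) ∨ p = (k * b * t : K) := by
  obtain ⟨l, hp, hl | hl⟩ := h
  · exact ⟨k⁻¹ * l, QuotientGroup.eq.mp hl, by simpa using Or.inl hp⟩
  · exact ⟨k⁻¹ * (l * t⁻¹), QuotientGroup.eq.mp hl, by simpa using Or.inr hp⟩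

theorem cosetGraph_reachable_smul {x y : (K ⧸ A) ⊕ (K ⧸ B)}
    (h : (cosetGraph A B t).Reachable x y) (k : K) :
    (cosetGraph A B t).Reachable (k • x) (k • y) := by
  let f : cosetGraph A B t →g cosetGraph A B t :=
    ⟨fun x => k • x, by
      rintro (p | p) (q | q) h
      exacts [h, CosetIncident.smul h k, CosetIncident.smul h k, h]⟩
  exact h.map f

theorem cosetGraph_reachable (hgen : Subgroup.closure ((A : Set K) ∪ B ∪ {t}) = ⊤) (k : K) :
    (cosetGraph A B t).Reachable (.inl ((1 : K) : K ⧸ A)) (.inl (k : K ⧸ A)) := by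
  have hk : k ∈ Subgroup.closure ((A : Set K) ∪ B ∪ {t}) := hgen ▸ Subgroup.mem_top k
  have hsmul (k l m : K)
      (h : (cosetGraph A B t).Reachable (.inl (k : K ⧸ A)) (.inl (l : K ⧸ A))) :
      (cosetGraph A B t).Reachable (.inl ((m * k : K) : K ⧸ A)) (.inl ((m * l : K) : K ⧸ A)) :=
    cosetGraph_reachable_smul h m
  have hadj (k : K) :
      (cosetGraph A B t).Reachable (.inl (k : K ⧸ A)) (.inr (k : K ⧸ B)) :=
    SimpleGraph.Adj.reachable (show CosetIncident A B t _ _ from ⟨k, rfl, Or.inl rfl⟩)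
  induction hk using Subgroup.closure_induction with
  | one => rfl
  | mul x y _ _ hx hy => exact hx.trans (by simpa using hsmul _ _ x hy)
  | inv x _ hx => exact (by simpa using hsmul _ _ x⁻¹ hx : SimpleGraph.Reachable _ _ _).symm
  | mem x hx =>
    rcases hx with (hx | hx) | rfl
    · rw [(QuotientGroup.eq.mpr (by simpa using hx) : ((1 : K) : K ⧸ A) = x)]
    · have h1 := hadj 1
      rw [(QuotientGroup.eq.mpr (by simpa using hx) : ((1 : K) : K ⧸ B) = x)] at h1
      exact h1.trans (hadj x).symm
    · refine (hadj 1).trans (SimpleGraph.Adj.reachable ?_).symm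
      exact (show CosetIncident A B x _ _ from ⟨x, rfl, Or.inr (by simp)⟩)

variable {V : Type*} [MulAction K V] {v w : V}

/-- The equivariant map from cosets of `A` and `B` to the orbits of a point fixed by `A` and
a point fixed by `B`. -/
def cosetMap (hA : A ≤ MulAction.stabilizer K v) (hB : B ≤ MulAction.stabilizer K w) :
    (K ⧸ A) ⊕ (K ⧸ B) → V :=
  Sum.elim
    (Quotient.lift (fun k : K => k • v) fun a b hab => by
      have h := hA (QuotientGroup.leftRel_apply.mp hab)
      rwa [MulAction.mem_stabilizer_iff, mul_smul, inv_smul_eq_iff, eq_comm] at h)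
    (Quotient.lift (fun k : K => k • w) fun a b hab => by
      have h := hB (QuotientGroup.leftRel_apply.mp hab)
      rwa [MulAction.mem_stabilizer_iff, mul_smul, inv_smul_eq_iff, eq_comm] at h)

/-- A group acting on a tree, generated by subgroups `A`, `B` fixing adjacent vertices `v`, `w`
together with an element `t` carrying another neighbour of `v` to `w`, subject to local
conditions at `v` and `w`: then `A` is the full stabilizer of `v`. -/
theorem stabilizer_le_of_local_conditions {T : SimpleGraph V} (hT : T.IsAcyclic)
    (hsimp : ∀ (k : K) (x y : V), T.Adj x y → T.Adj (k • x) (k • y))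
    (hvw : T.Adj v w) (hvt : T.Adj v (t⁻¹ • w))
    (hA : A ≤ MulAction.stabilizer K v) (hB : B ≤ MulAction.stabilizer K w)
    (hgen : Subgroup.closure ((A : Set K) ∪ B ∪ {t}) = ⊤)
    (hAB : ∀ a ∈ A, a • w = w → a ∈ B)
    (hAt : ∀ a ∈ A, a • t⁻¹ • w = t⁻¹ • w → t * a * t⁻¹ ∈ B)
    (hAne : ∀ a ∈ A, a • w ≠ t⁻¹ • w)
    (hBA : ∀ b ∈ B, b • v = v → b ∈ A)
    (hBt : ∀ b ∈ B, b • t • v = t • v → t⁻¹ * b * t ∈ A)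
    (hBne : ∀ b ∈ B, b • v ≠ t • v) :
    MulAction.stabilizer K v ≤ A := by
  have hadj {p : K ⧸ A} {q : K ⧸ B} (h : CosetIncident A B t p q) :
      T.Adj (cosetMap hA hB (.inl p)) (cosetMap hA hB (.inr q)) := by
    obtain ⟨k, rfl, rfl | rfl⟩ := h
    · exact hsimp k _ _ hvw
    · have h := hsimp k _ _ hvt
      rwa [smul_smul] at h
  let f : cosetGraph A B t →g T :=
    ⟨cosetMap hA hB, by
      rintro (p | p) (q | q) h
      exacts [h.elim, hadj h, (hadj h).symm, h.elim]⟩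
  have hf (x) : Set.InjOn f ((cosetGraph A B t).neighborSet x) := by
    rcases x with p | q
    · induction p using QuotientGroup.induction_on with | _ k
      rintro (_ | q₁) h₁ (_ | q₂) h₂ he
      any_goals exact h₁.elim
      any_goals exact h₂.elim
      obtain ⟨a, ha, rfl | rfl⟩ := CosetIncident.exists_right h₁ <;>
      obtain ⟨b, hb, rfl | rfl⟩ := CosetIncident.exists_right h₂
      · change (k * a) • w = (k * b) • w at he
        have := hAB (a⁻¹ * b) (mul_mem (inv_mem ha) hb)
          (by rw [mul_smul, inv_smul_eq_iff]; simpa [mul_smul] using he.symm)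
        exact congrArg _ (QuotientGroup.eq.mpr (by convert this using 1; group))
      · change (k * a) • w = (k * b * t⁻¹) • w at he
        refine (hAne (b⁻¹ * a) (mul_mem (inv_mem hb) ha) ?_).elim
        rw [mul_smul, inv_smul_eq_iff]; simpa [mul_smul] using he
      · change (k * a * t⁻¹) • w = (k * b) • w at he
        refine (hAne (a⁻¹ * b) (mul_mem (inv_mem ha) hb) ?_).elim
        rw [mul_smul, inv_smul_eq_iff]; simpa [mul_smul] using he.symm
      · change (k * a * t⁻¹) • w = (k * b * t⁻¹) • w at he
        have := hAt (a⁻¹ * b) (mul_mem (inv_mem ha) hb)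
          (by rw [mul_smul, inv_smul_eq_iff]; simpa [mul_smul] using he.symm)
        exact congrArg _ (QuotientGroup.eq.mpr (by convert this using 1; group))
    · induction q using QuotientGroup.induction_on with | _ k
      rintro (p₁ | _) h₁ (p₂ | _) h₂ he
      any_goals exact h₁.elim
      any_goals exact h₂.elim
      obtain ⟨a, ha, rfl | rfl⟩ := CosetIncident.exists_left h₁ <;>
      obtain ⟨b, hb, rfl | rfl⟩ := CosetIncident.exists_left h₂
      · change (k * a) • v = (k * b) • v at he
        have := hBA (a⁻¹ * b) (mul_mem (inv_mem ha) hb)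
          (by rw [mul_smul, inv_smul_eq_iff]; simpa [mul_smul] using he.symm)
        exact congrArg _ (QuotientGroup.eq.mpr (by convert this using 1; group))
      · change (k * a) • v = (k * b * t) • v at he
        refine (hBne (b⁻¹ * a) (mul_mem (inv_mem hb) ha) ?_).elim
        rw [mul_smul, inv_smul_eq_iff]; simpa [mul_smul] using he
      · change (k * a * t) • v = (k * b) • v at he
        refine (hBne (a⁻¹ * b) (mul_mem (inv_mem ha) hb) ?_).elim
        rw [mul_smul, inv_smul_eq_iff]; simpa [mul_smul] using he.symm
      · change (k * a * t) • v = (k * b * t) • v at he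
        have := hBt (a⁻¹ * b) (mul_mem (inv_mem ha) hb)
          (by rw [mul_smul, inv_smul_eq_iff]; simpa [mul_smul] using he.symm)
        exact congrArg _ (QuotientGroup.eq.mpr (by convert this using 1; group))
  intro k hk
  have he : f (.inl ((1 : K) : K ⧸ A)) = f (.inl (k : K ⧸ A)) := by
    change (1 : K) • v = k • v
    rw [one_smul, MulAction.mem_stabilizer_iff.mp hk]
  have h := hT.eq_of_locally_injective f hf (cosetGraph_reachable hgen k) he
  simpa using QuotientGroup.eq.mp (Sum.inl_injective h)

end BassSerre

namespace AmalgamatedProduct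

variable {H : Type*} {X Y : Type u} [Group H] [Group X] [Group Y] {f : H →* X} {g : H →* Y}

theorem inl_apply_eq_inr_apply (x : H) :
    (inl (f x) : AmalgamatedProduct f g) = inr (g x) :=
  (Monoid.PushoutI.of_apply_eq_base (boolFamHom f g) true x).trans
    (Monoid.PushoutI.of_apply_eq_base (boolFamHom f g) false x).symm

theorem exists_lift {M : Type*} [Group M] (a : X →* M) (b : Y →* M)
    (hab : ∀ x, a (f x) = b (g x)) :
    ∃ F : AmalgamatedProduct f g →* M, (∀ x, F (inl x) = a x) ∧ ∀ y, F (inr y) = b y := by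
  let c : ∀ i, BoolFam X Y i →* M
    | true => a
    | false => b
  refine ⟨Monoid.PushoutI.lift c (a.comp f) ?_, fun x => ?_, fun y => ?_⟩
  · rintro (_ | _)
    · exact MonoidHom.ext fun x => (hab x).symm
    · rfl
  · exact Monoid.PushoutI.lift_of (φ := boolFamHom f g) c _ _ (i := true) x
  · exact Monoid.PushoutI.lift_of (φ := boolFamHom f g) c _ _ (i := false) y

theorem mem_of_inl_inr (S : Subgroup (AmalgamatedProduct f g)) (hX : ∀ x, inl x ∈ S)
    (hY : ∀ y, inr y ∈ S) (p : AmalgamatedProduct f g) : p ∈ S := by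
  induction p using Monoid.PushoutI.induction_on with
  | of i x =>
    cases i
    · exact hY x
    · exact hX x
  | base x =>
    rw [← Monoid.PushoutI.of_apply_eq_base (boolFamHom f g) true x]
    exact hX (f x)
  | mul x y hx hy => exact mul_mem hx hy

end AmalgamatedProduct

/-- **Subgroups generated by two vertex groups and an edge-translating element**
(Proposition on controlled splittings, case (4)).  Let `G` act simplicially without
inversions on a tree, `e₁ = {v,w}` and `e₂ = {v,z}` distinct edges at `v`, `G_v, G_w, G_z`
subgroups fixing `v, w, z`, and `h ∈ G` with `w = h • z` and `G_w = h G_z h⁻¹`.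
Suppose `C₁ := G_v ∩ Stab(e₁) = G_w ∩ Stab(e₁)`, `C₂ := G_v ∩ Stab(e₂) = G_z ∩ Stab(e₂)`,
no element of `G_v` maps `w` to `z`, and no element of `G_w` maps `v` to `h • v`.  Then the
canonical homomorphism into `G` from the HNN extension of `G_v *_{C₁} G_w` along
`C₂ → hC₂h⁻¹`, `k ↦ hkh⁻¹`, sending the stable letter to `h`, is injective; in particular
`⟨G_v ∪ G_w ∪ {h}⟩ ≅ (G_v *_{C₁} G_w) *_{C₂}`. -/
theorem hnn_extension_of_vertex_amalgam_embeds
    {G V : Type*} [Group G] (T : SimpleGraph V) (hT : T.IsTree)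
    [MulAction G V]
    (hsimp : ∀ (g : G) (u v : V), T.Adj u v → T.Adj (g • u) (g • v))
    (hninv : ∀ (g : G) (u v : V), T.Adj u v → ¬(g • u = v ∧ g • v = u))
    (v w z : V) (hvw : T.Adj v w) (hvz : T.Adj v z) (hwz : w ≠ z)
    (Gv Gw Gz : Subgroup G)
    (hGv : ∀ g ∈ Gv, g • v = v) (hGw : ∀ g ∈ Gw, g • w = w) (hGz : ∀ g ∈ Gz, g • z = z)
    (h : G) (hwhz : w = h • z)
    (hGwGz : ∀ x : G, x ∈ Gw ↔ h⁻¹ * x * h ∈ Gz)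
    (hC₁ : edgeGroup Gv v w = edgeGroup Gw v w)
    (hC₂ : edgeGroup Gv v z = edgeGroup Gz v z)
    (hC₂w : Subgroup.map (MulAut.conj h).toMonoidHom (edgeGroup Gv v z) ≤ Gw)
    (hdiff₁ : ¬ ∃ a ∈ Gv, a • w = z)
    (hdiff₂ : ¬ ∃ u ∈ Gw, u • v = h • v)
    (φ : assocSubgroupA z Gv Gw hC₁ ≃* assocSubgroupB z h Gv Gw hC₁)
    (hφ : ∀ (x : G) (hx : x ∈ edgeGroup Gv v z) (hy : h * x * h⁻¹ ∈ Gw),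
      (↑(φ (assocElemA z Gv Gw hC₁ x hx)) : VertexAmalgam Gv Gw hC₁) =
        AmalgamatedProduct.inr ⟨h * x * h⁻¹, hy⟩) :
    ∃ F : HNNExtension (VertexAmalgam Gv Gw hC₁)
        (assocSubgroupA z Gv Gw hC₁) (assocSubgroupB z h Gv Gw hC₁) φ →* G,
      (∀ x : Gv, F (HNNExtension.of (AmalgamatedProduct.inl x)) = (x : G)) ∧
      (∀ y : Gw, F (HNNExtension.of (AmalgamatedProduct.inr y)) = (y : G)) ∧
      F HNNExtension.t = h ∧
      Function.Injective F := by
  obtain ⟨F₀, hF₀v, hF₀w⟩ := AmalgamatedProduct.exists_lift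
    (f := Subgroup.inclusion (inf_le_left : edgeGroup Gv v w ≤ Gv))
    (g := Subgroup.inclusion (hC₁.le.trans inf_le_left : edgeGroup Gv v w ≤ Gw))
    Gv.subtype Gw.subtype fun _ => rfl
  have hφx (x : G) (hx : x ∈ edgeGroup Gv v z) : h * x * h⁻¹ ∈ Gw :=
    hC₂w (Subgroup.mem_map_of_mem _ hx)
  have hcomp (a : assocSubgroupA z Gv Gw hC₁) : h * F₀ a = F₀ (φ a) * h := by
    obtain ⟨_, ⟨x, hx₁⟩, hx, rfl⟩ := a
    have hx' : x ∈ edgeGroup Gv v z := hx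
    have hφa := hφ x hx' (hφx x hx')
    change h * F₀ (AmalgamatedProduct.inl _) = F₀ (φ (assocElemA z Gv Gw hC₁ x hx')) * h
    rw [hφa, hF₀v, hF₀w]
    simp
  let F := HNNExtension.lift F₀ h hcomp
  have hFv (x : Gv) : F (HNNExtension.of (AmalgamatedProduct.inl x)) = (x : G) := by
    rw [HNNExtension.lift_of, hF₀v]; rfl
  have hFw (x : Gw) : F (HNNExtension.of (AmalgamatedProduct.inr x)) = (x : G) := by
    rw [HNNExtension.lift_of, hF₀w]; rfl
  have hFt : F HNNExtension.t = h := HNNExtension.lift_t _ _ _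
  refine ⟨F, hFv, hFw, hFt, (injective_iff_map_eq_one F).mpr fun k hk => ?_⟩
  have hz : z = h⁻¹ • w := by rw [hwhz, inv_smul_smul]
  have htx (x : G) (hx : x ∈ edgeGroup Gv v z) :
      (HNNExtension.t * HNNExtension.of (AmalgamatedProduct.inl ⟨x, hx.1⟩) * HNNExtension.t⁻¹ :
        HNNExtension (VertexAmalgam Gv Gw hC₁) _ _ φ) =
      HNNExtension.of (AmalgamatedProduct.inr ⟨h * x * h⁻¹, hφx x hx⟩) := by
    rw [← hφ x hx (hφx x hx), HNNExtension.equiv_eq_conj]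
    rfl
  have hinlr (x : G) (hx : x ∈ edgeGroup Gv v w) :
      (AmalgamatedProduct.inl ⟨x, hx.1⟩ : VertexAmalgam Gv Gw hC₁) =
        AmalgamatedProduct.inr ⟨x, (hC₁.le hx).1⟩ :=
    AmalgamatedProduct.inl_apply_eq_inr_apply (⟨x, hx⟩ : edgeGroup Gv v w)
  let iv : Gv →* HNNExtension (VertexAmalgam Gv Gw hC₁) (assocSubgroupA z Gv Gw hC₁)
    (assocSubgroupB z h Gv Gw hC₁) φ := HNNExtension.of.comp AmalgamatedProduct.inl
  let iw : Gw →* HNNExtension (VertexAmalgam Gv Gw hC₁) (assocSubgroupA z Gv Gw hC₁)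
    (assocSubgroupB z h Gv Gw hC₁) φ := HNNExtension.of.comp AmalgamatedProduct.inr
  have hFv' (x : Gv) : F (iv x) = x := hFv x
  have hFw' (x : Gw) : F (iw x) = x := hFw x
  let act := MulAction.compHom V F
  have hsmul (k) (x : V) : k • x = F k • x := rfl
  have hmem : k ∈ iv.range := by
    refine stabilizer_le_of_local_conditions (A := iv.range) (B := iw.range)
      (t := HNNExtension.t) (v := v) (w := w) hT.isAcyclic (fun k => hsimp (F k)) hvw
      ?_ ?_ ?_ ?_ ?_ ?_ ?_ ?_ ?_ ?_ ?_
    · rwa [hsmul, map_inv, hFt, ← hz]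
    · rintro _ ⟨x, rfl⟩
      rw [MulAction.mem_stabilizer_iff, hsmul, hFv']
      exact hGv x x.2
    · rintro _ ⟨x, rfl⟩
      rw [MulAction.mem_stabilizer_iff, hsmul, hFw']
      exact hGw x x.2
    · rw [eq_top_iff]
      rintro k -
      induction k using HNNExtension.induction_on with
      | of g =>
        refine Subgroup.mem_comap.mp (AmalgamatedProduct.mem_of_inl_inr _
          (fun x => Subgroup.mem_comap.mpr ?_) (fun x => Subgroup.mem_comap.mpr ?_) g)
        · exact Subgroup.subset_closure (Or.inl (Or.inl ⟨x, rfl⟩))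
        · exact Subgroup.subset_closure (Or.inl (Or.inr ⟨x, rfl⟩))
      | t => exact Subgroup.subset_closure (Or.inr rfl)
      | mul x y hx hy => exact mul_mem hx hy
      | inv x hx => exact inv_mem hx
    · rintro _ ⟨⟨x, hx⟩, rfl⟩ he
      rw [hsmul, hFv'] at he
      exact ⟨_, congrArg HNNExtension.of (hinlr x ⟨hx, hGv x hx, he⟩).symm⟩
    · rintro _ ⟨⟨x, hx⟩, rfl⟩ he
      rw [hsmul, hFv', hsmul, map_inv, hFt, ← hz] at he
      exact ⟨_, (htx x ⟨hx, hGv x hx, he⟩).symm⟩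
    · rintro _ ⟨⟨x, hx⟩, rfl⟩ he
      rw [hsmul, hFv', hsmul, map_inv, hFt, ← hz] at he
      exact hdiff₁ ⟨x, hx, he⟩
    · rintro _ ⟨⟨x, hx⟩, rfl⟩ he
      rw [hsmul, hFw'] at he
      exact ⟨_, congrArg HNNExtension.of (hinlr x (hC₁.ge ⟨hx, he, hGw x hx⟩))⟩
    · rintro _ ⟨⟨x, hx⟩, rfl⟩ he
      rw [hsmul, hFw', hsmul, hFt] at he
      have hxz := (hGwGz x).mp hx
      have hx₂ : h⁻¹ * x * h ∈ edgeGroup Gv v z :=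
        hC₂.ge ⟨hxz, MulAction.mem_stabilizer_iff.mpr (by
          rw [mul_smul, mul_smul, inv_smul_eq_iff]
          exact he), hGz _ hxz⟩
      refine ⟨⟨h⁻¹ * x * h, hx₂.1⟩, ?_⟩
      have ht := htx _ hx₂
      rw [mul_inv_eq_iff_eq_mul] at ht
      have hx' : (⟨h * (h⁻¹ * x * h) * h⁻¹, hφx _ hx₂⟩ : Gw) = ⟨x, hx⟩ :=
        Subtype.ext (by group)
      rw [hx'] at ht
      exact (eq_inv_mul_of_mul_eq ht).trans (mul_assoc _ _ _).symm
    · rintro _ ⟨⟨x, hx⟩, rfl⟩ he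
      rw [hsmul, hFw', hsmul, hFt] at he
      exact hdiff₂ ⟨x, hx, he⟩
    · rw [MulAction.mem_stabilizer_iff, hsmul, hk, one_smul]
  obtain ⟨x, rfl⟩ := hmem
  rw [hFv', OneMemClass.coe_eq_one] at hk
  rw [hk, map_one]
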